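/- Let d ≥ 3 and let b : ℝ^d → ℝ^d be a bounded measurable vector field. Then there is a constant C > 0 depending only on d such that for all f ∈ C_0^1(ℝ^d), ‖ |x|^{-1} f ‖_{L^2(ℝ^d)} ≤ C ‖ (i∇ + b) f ‖_{L^2(ℝ^d)} (magnetic Hardy/Poincaré inequality). -/

import Mathlib

open MeasureTheory Complex

lemma int_zero {d : ℕ} (g : EuclideanSpace ℝ (Fin d) → ℝ) (hg : ContDiff ℝ 1 g)
    (hc : HasCompactSupport g) (v : EuclideanSpace ℝ (Fin d)) :
    Integrable (fun x => fderiv ℝ g x v) ∧ ∫ x, fderiv ℝ g x v = 0 := by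
  have hcont : Continuous (fun x => fderiv ℝ g x v) :=
    (hg.continuous_fderiv (by norm_num)).clm_apply continuous_const
  have hi : Integrable (fun x => fderiv ℝ g x v) :=
    hcont.integrable_of_hasCompactSupport (hc.fderiv_apply ℝ v)
  refine ⟨hi, ?_⟩
  have := integral_mul_fderiv_eq_neg_fderiv_mul_of_integrable (𝕜 := ℝ) (μ := volume)
    (f := fun _ : EuclideanSpace ℝ (Fin d) => (1:ℝ)) (g := g) (v := v)
    (by simp) (by simpa using hi)
    (by simpa using hg.continuous.integrable_of_hasCompactSupport hc) (by fun_prop)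
    (fun x _ => hg.differentiable (by norm_num) x)
  simpa using this

lemma deriv_formula {d : ℕ} (f : EuclideanSpace ℝ (Fin d) → ℂ) (hf : ContDiff ℝ 1 f) {ε : ℝ}
    (hε : 0 < ε) (j : Fin d) (x : EuclideanSpace ℝ (Fin d)) :
    fderiv ℝ (fun y : EuclideanSpace ℝ (Fin d) => y j * (‖y‖^2+ε)⁻¹ * ‖f y‖^2) x
      (EuclideanSpace.single j 1) =
    ((‖x‖^2+ε)⁻¹ - 2 * (x j)^2 * ((‖x‖^2+ε)⁻¹)^2) * ‖f x‖^2 +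
     2 * (x j * (‖x‖^2+ε)⁻¹) * inner ℝ (f x) (fderiv ℝ f x (EuclideanSpace.single j 1)) := by
  have hq : ‖x‖^2+ε ≠ 0 := by positivity
  have h1 : HasFDerivAt (fun y : EuclideanSpace ℝ (Fin d) => y j)
    (EuclideanSpace.proj j : EuclideanSpace ℝ (Fin d) →L[ℝ] ℝ) x :=
    (EuclideanSpace.proj j : EuclideanSpace ℝ (Fin d) →L[ℝ] ℝ).hasFDerivAt
  have h2 := (hasDerivAt_inv hq).comp_hasFDerivAt x ((hasFDerivAt_id x).norm_sq.add_const ε)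
  have h3 := ((hf.differentiable (by norm_num)) x).hasFDerivAt.norm_sq
  have h4 := (h1.mul h2).mul h3
  have h5 := h4.fderiv
  simp only [id] at h5
  have h6 : (fun y : EuclideanSpace ℝ (Fin d) => y j * (‖y‖^2+ε)⁻¹ * ‖f y‖^2) = 
    ((fun y : EuclideanSpace ℝ (Fin d) => y j) * (fun y => y⁻¹) ∘ fun y => ‖y‖^2+ε) * fun y => ‖f y‖^2 := rfl
  rw [h6, h5]
  simp [EuclideanSpace.inner_single_right]
  field_simp
  ring

lemma ptwise (z w : ℂ) (β t : ℝ) : 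
   - (1/2) * t^2 * ‖z‖^2 - 2 * ‖I * w + (β:ℂ) * z‖^2 ≤ 2 * t * inner ℝ z w := by
  rw [Complex.inner, ← Complex.normSq_eq_norm_sq, ← Complex.normSq_eq_norm_sq, normSq_apply, normSq_apply]
  simp
  nlinarith [sq_nonneg (2 * (w.re + β * z.im) + t * z.re), sq_nonneg (2 * (-w.im + β * z.re) - t * z.im)]


lemma D_bound (z w : ℂ) (β M : ℝ) (h : ‖β‖ ≤ M) :
    ‖I * w + (β:ℂ) * z‖^2 ≤ 2 * ‖w‖^2 + 2 * M^2 * ‖z‖^2 := by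
  have h2 := norm_add_le (I * w) ((β : ℂ) * z)
  rw [norm_mul, norm_mul, Complex.norm_I, one_mul, Complex.norm_real] at h2
  have h3 : ‖β‖ * ‖z‖ ≤ M * ‖z‖ := by gcongr
  have h4 : ‖I * w + (β:ℂ) * z‖ ≤ ‖w‖ + M * ‖z‖ := by linarith
  have h5 := pow_le_pow_left₀ (norm_nonneg _) h4 2
  refine h5.trans ?_
  nlinarith [sq_nonneg (‖w‖ - M * ‖z‖)]

lemma cs_norm_sq {d : ℕ} (f : EuclideanSpace ℝ (Fin d) → ℂ) (hc : HasCompactSupport f) :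
    HasCompactSupport (fun x => ‖f x‖^2) :=
  hc.comp_left (g := fun z : ℂ => ‖z‖^2) (by simp)

lemma D_integrable {d : ℕ} (b : EuclideanSpace ℝ (Fin d) → EuclideanSpace ℝ (Fin d))
    (hb : Measurable b) (M : ℝ) (hM : ∀ x, ‖b x‖ ≤ M)
    (f : EuclideanSpace ℝ (Fin d) → ℂ) (hf : ContDiff ℝ 1 f) (hc : HasCompactSupport f)
    (j : Fin d) :
    Integrable (fun x => ‖Complex.I * fderiv ℝ f x (EuclideanSpace.single j 1)
                  + (b x j : ℂ) * f x‖ ^ 2) := by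
  have hcont : Continuous (fun x => fderiv ℝ f x (EuclideanSpace.single j 1)) :=
    (hf.continuous_fderiv (by norm_num)).clm_apply continuous_const
  have hc' : HasCompactSupport (fun x => fderiv ℝ f x (EuclideanSpace.single j 1)) :=
    hc.fderiv_apply ℝ _
  have i1 : Integrable (fun x => ‖fderiv ℝ f x (EuclideanSpace.single j 1)‖^2) :=
    (hcont.norm.pow 2).integrable_of_hasCompactSupport (cs_norm_sq _ hc')
  have i2 : Integrable (fun x => ‖f x‖^2) :=
    (hf.continuous.norm.pow 2).integrable_of_hasCompactSupport (cs_norm_sq _ hc)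
  have i3 : Integrable (fun x => 2 * ‖fderiv ℝ f x (EuclideanSpace.single j 1)‖^2
      + 2 * M^2 * ‖f x‖^2) := (i1.const_mul 2).add (i2.const_mul (2 * M^2))
  clear i1 i2
  refine i3.mono' ?_ ?_
  · have hbj : Measurable (fun x => b x j) :=
      (EuclideanSpace.proj j : EuclideanSpace ℝ (Fin d) →L[ℝ] ℝ).continuous.measurable.comp hb
    have h1 := hcont.measurable
    have h2 := hf.continuous.measurable
    exact ((((h1.const_mul Complex.I).add
      ((Complex.measurable_ofReal.comp hbj).mul h2)).norm).pow_const 2).aestronglyMeasurable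
  · refine Filter.Eventually.of_forall fun x => ?_
    have h1 : ‖b x j‖ ≤ M := (PiLp.norm_apply_le (b x) j).trans (hM x)
    rw [Real.norm_of_nonneg (sq_nonneg _)]
    exact D_bound (f x) (fderiv ℝ f x (EuclideanSpace.single j 1)) (b x j) M h1

lemma reg_ineq {d : ℕ} (hd : 3 ≤ d) (b : EuclideanSpace ℝ (Fin d) → EuclideanSpace ℝ (Fin d))
    (hb : Measurable b) (M : ℝ) (hM : ∀ x, ‖b x‖ ≤ M)
    (f : EuclideanSpace ℝ (Fin d) → ℂ) (hf : ContDiff ℝ 1 f) (hc : HasCompactSupport f)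
    {ε : ℝ} (hε : 0 < ε) :
    ∫ x : EuclideanSpace ℝ (Fin d), (‖x‖^2+ε)⁻¹ * ‖f x‖^2 ≤
      4 * ∫ x : EuclideanSpace ℝ (Fin d), ∑ j : Fin d,
        ‖Complex.I * fderiv ℝ f x (EuclideanSpace.single j 1) + (b x j : ℂ) * f x‖ ^ 2 := by
  have hq : ∀ x : EuclideanSpace ℝ (Fin d), ‖x‖^2+ε ≠ 0 := fun x => by positivity
  have hcs : HasCompactSupport (fun x => ‖f x‖^2) :=
    hc.comp_left (g := fun z => ‖z‖^2) (by simp)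
  have hG : ∀ j : Fin d, ContDiff ℝ 1
      (fun y : EuclideanSpace ℝ (Fin d) => y j * (‖y‖^2+ε)⁻¹ * ‖f y‖^2) := fun j =>
    ((contDiff_euclidean.1 contDiff_id j).mul
      (((contDiff_id.norm_sq ℝ).add contDiff_const).inv hq)).mul (hf.norm_sq ℝ)
  have hGi := fun j : Fin d => int_zero _ (hG j) hcs.mul_left (EuclideanSpace.single j 1)
  have hDi := D_integrable b hb M hM f hf hc
  have hDs := integrable_finsetSum Finset.univ (fun j _ => hDi j)
  have hGs := integrable_finsetSum Finset.univ (fun j _ => (hGi j).1)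
  have hL : Integrable (fun x : EuclideanSpace ℝ (Fin d) => (‖x‖^2+ε)⁻¹ * ‖f x‖^2) := by
    refine Continuous.integrable_of_hasCompactSupport ?_ hcs.mul_left
    exact (((continuous_norm.pow 2).add continuous_const).inv₀ hq).mul (hf.continuous.norm.pow 2)
  have key := integral_mono hL ((hGs.const_mul 2).add (hDs.const_mul 4)) (fun x => by
    simp only [Pi.add_apply]
    rw [Finset.mul_sum, Finset.mul_sum, ← Finset.sum_add_distrib]
    set r := (‖x‖^2+ε)⁻¹ with hr
    have hr0 : 0 < r := by positivity
    have step : ∑ j : Fin d, (2 * r - 5 * (x j)^2 * r^2) * ‖f x‖^2 ≤ 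
       ∑ j : Fin d, (2 * fderiv ℝ (fun y : EuclideanSpace ℝ (Fin d) =>
          y j * (‖y‖^2+ε)⁻¹ * ‖f y‖^2) x (EuclideanSpace.single j 1) + 4 * 
          ‖Complex.I * fderiv ℝ f x (EuclideanSpace.single j 1) + (b x j : ℂ) * f x‖ ^ 2) := by
      refine Finset.sum_le_sum fun j _ => ?_
      rw [deriv_formula f hf hε j x, ← hr]
      have := ptwise (f x) (fderiv ℝ f x (EuclideanSpace.single j 1)) (b x j) (x j * r)
      nlinarith [this]
    refine le_trans ?_ step
    rw [← Finset.sum_mul, Finset.sum_sub_distrib, ← Finset.sum_mul (f := fun j => 5 * (x j)^2), ← Finset.mul_sum (f := fun j => (x j)^2),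
      ← EuclideanSpace.real_norm_sq_eq]
    simp only [Finset.sum_const, Finset.card_univ, Fintype.card_fin, nsmul_eq_mul]
    have hd' : (3:ℝ) ≤ d := by exact_mod_cast hd
    have e : ‖x‖^2 * r ≤ 1 := by
      rw [hr, ← div_eq_mul_inv, div_le_one (by positivity)]; linarith
    gcongr
    nlinarith [mul_le_mul_of_nonneg_right e hr0.le, mul_le_mul_of_nonneg_right hd' hr0.le])
  simp only [Pi.add_apply] at key
  rw [integral_add (hGs.const_mul 2) (hDs.const_mul 4), integral_const_mul, integral_const_mul,
    integral_finsetSum _ (fun j _ => (hGi j).1)] at key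
  simpa [(hGi _).2] using key

/-- magnetic Hardy/Poincaré inequality. For `d ≥ 3` there is a constant `C > 0`
depending only on `d` such that for every bounded measurable vector field `b` on `ℝ^d` and every
`C¹` compactly supported `f : ℝ^d → ℂ`,
`‖ |x|⁻¹ f ‖_{L²} ≤ C ‖ (i∇ + b) f ‖_{L²}`. -/
theorem stmt_3 (d : ℕ) (hd : 3 ≤ d) :
    ∃ C > 0, ∀ b : EuclideanSpace ℝ (Fin d) → EuclideanSpace ℝ (Fin d),
      Measurable b → (∃ M : ℝ, ∀ x, ‖b x‖ ≤ M) →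
      ∀ f : EuclideanSpace ℝ (Fin d) → ℂ,
        ContDiff ℝ 1 f → HasCompactSupport f →
        Real.sqrt (∫ x : EuclideanSpace ℝ (Fin d), ‖x‖⁻¹ ^ 2 * ‖f x‖ ^ 2)
          ≤ C * Real.sqrt (∫ x : EuclideanSpace ℝ (Fin d),
              ∑ j : Fin d,
                ‖Complex.I * fderiv ℝ f x (EuclideanSpace.single j 1)
                  + (b x j : ℂ) * f x‖ ^ 2) := by
  refine ⟨2, by norm_num, fun b hb ⟨M, hM⟩ f hf hc => ?_⟩
  have h2 : (2:ℝ) = Real.sqrt 4 := by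
    rw [show (4:ℝ) = 2^2 by norm_num, Real.sqrt_sq (by norm_num)]
  rw [h2, ← Real.sqrt_mul (by norm_num)]
  apply Real.sqrt_le_sqrt
  by_cases hi : Integrable
    (fun x : EuclideanSpace ℝ (Fin d) => ‖x‖⁻¹ ^ 2 * ‖f x‖ ^ 2)
  swap
  · rw [integral_undef hi]
    exact mul_nonneg (by norm_num)
      (integral_nonneg fun x => Finset.sum_nonneg fun j _ => by positivity)
  have : Nonempty (Fin d) := ⟨⟨0, by omega⟩⟩
  have hne : ∀ᵐ x : EuclideanSpace ℝ (Fin d), x ≠ 0 := by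
    simp [ae_iff]
  have lim : Filter.Tendsto (fun n : ℕ => ∫ x : EuclideanSpace ℝ (Fin d),
      (‖x‖^2 + 1 / ((n:ℝ) + 1))⁻¹ * ‖f x‖^2) Filter.atTop
      (nhds (∫ x : EuclideanSpace ℝ (Fin d), ‖x‖⁻¹ ^ 2 * ‖f x‖ ^ 2)) := by
    refine tendsto_integral_of_dominated_convergence _ (fun n => ?_) hi (fun n => ?_) ?_
    · refine Continuous.aestronglyMeasurable ?_
      exact (((continuous_norm.pow 2).add continuous_const).inv₀
        (fun x => (by positivity : 0 < ‖x‖^2 + 1 / ((n:ℝ) + 1)).ne')).mul (hf.continuous.norm.pow 2)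
    · filter_upwards [hne] with x hx
      have : 0 < ‖x‖ := norm_pos_iff.2 hx
      rw [Real.norm_of_nonneg (by positivity), inv_pow]
      gcongr
      have : 0 < 1 / ((n:ℝ) + 1) := by positivity
      linarith
    · filter_upwards [hne] with x hx
      have : 0 < ‖x‖ := norm_pos_iff.2 hx
      rw [inv_pow]
      refine Filter.Tendsto.mul_const _ (Filter.Tendsto.inv₀ ?_ (by positivity))
      simpa using (tendsto_one_div_add_atTop_nhds_zero_nat (𝕜 := ℝ)).const_add (‖x‖^2)
  exact le_of_tendsto' lim fun n => reg_ineq hd b hb M hM f hf hc (by positivity)
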